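/- Let p, p_r, q be strictly positive probability distributions on {1,...,C}, let η ∈ [0,1], and define p̃_η = softmax(log p + η·(log p_r − log q)). Then for any strictly positive distribution π on {1,...,C}: KL(π ‖ p̃_η) = KL(π ‖ p) + Δγ(η) + η·(KL(π ‖ p_r) − KL(π ‖ q)), where Δγ(η) = log(∑_y p(y)(p_r(y)/q(y))^η). -/

import Mathlib

noncomputable def softmax {C : ℕ} (z : Fin C → ℝ) : Fin C → ℝ :=
  fun i => Real.exp (z i) / ∑ j, Real.exp (z j)

/-- Kullback–Leibler divergence between finitely supported distributions. -/
noncomputable def klF {C : ℕ} (a b : Fin C → ℝ) : ℝ :=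
  ∑ y, a y * Real.log (a y / b y)

theorem exact_kl_decomposition {C : ℕ} (p pr q π : Fin C → ℝ)
    (hp : ∀ y, 0 < p y) (hpsum : ∑ y, p y = 1)
    (hpr : ∀ y, 0 < pr y) (hprsum : ∑ y, pr y = 1)
    (hq : ∀ y, 0 < q y) (hqsum : ∑ y, q y = 1)
    (hπ : ∀ y, 0 < π y) (hπsum : ∑ y, π y = 1)
    (η : ℝ) (hη : η ∈ Set.Icc (0 : ℝ) 1) :
    klF π (softmax (fun c => Real.log (p c) + η * (Real.log (pr c) - Real.log (q c))))
      = klF π p + Real.log (∑ y, p y * (pr y / q y) ^ η)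
        + η * (klF π pr - klF π q) := by
  have hexp : ∀ y, Real.exp (Real.log (p y) + η * (Real.log (pr y) - Real.log (q y)))
      = p y * (pr y / q y) ^ η := by
    intro y
    rw [Real.exp_add, Real.exp_log (hp y), Real.rpow_def_of_pos (div_pos (hpr y) (hq y)),
      Real.log_div (hpr y).ne' (hq y).ne', mul_comm η]
  have hne : (Finset.univ : Finset (Fin C)).Nonempty := by
    by_contra h
    rw [Finset.not_nonempty_iff_eq_empty] at h
    rw [h] at hpsum
    simp at hpsum
  have hZ : 0 < ∑ y, Real.exp (Real.log (p y) + η * (Real.log (pr y) - Real.log (q y))) :=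
    Finset.sum_pos (fun y _ => Real.exp_pos _) hne
  have hsum : ∑ y, p y * (pr y / q y) ^ η
      = ∑ y, Real.exp (Real.log (p y) + η * (Real.log (pr y) - Real.log (q y))) :=
    Finset.sum_congr rfl (fun y _ => (hexp y).symm)
  rw [hsum]
  unfold klF softmax
  generalize (∑ y, Real.exp (Real.log (p y) + η * (Real.log (pr y) - Real.log (q y)))) = Z at hZ ⊢
  have hlog : Real.log Z = ∑ y, π y * Real.log Z := by
    rw [← Finset.sum_mul, hπsum, one_mul]
  rw [hlog, ← Finset.sum_sub_distrib, Finset.mul_sum, ← Finset.sum_add_distrib,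
    ← Finset.sum_add_distrib]
  refine Finset.sum_congr rfl (fun y _ => ?_)
  rw [Real.log_div (hπ y).ne' (div_pos (Real.exp_pos _) hZ).ne',
    Real.log_div (Real.exp_pos _).ne' hZ.ne', Real.log_exp,
    Real.log_div (hπ y).ne' (hp y).ne', Real.log_div (hπ y).ne' (hpr y).ne',
    Real.log_div (hπ y).ne' (hq y).ne']
  ring
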